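/- There is no smooth effective action of the 3-torus on the 3-sphere. Precisely: there is no map μ : (S¹ × S¹ × S¹) × S³ → S³ that is smooth (C^∞ as a map of smooth manifolds), satisfies the action axioms μ(1, x) = x and μ(gh, x) = μ(g, μ(h, x)) for all g, h in the torus and x ∈ S³, and is effective, i.e. for every group element g ≠ 1 there exists x ∈ S³ with μ(g, x) ≠ x. -/

import Mathlib

open scoped Manifold

noncomputable instance : Fact (Module.finrank ℝ (EuclideanSpace ℝ (Fin 4)) = 3 + 1) :=
  ⟨by simp [finrank_euclideanSpace_fin]⟩

/-- The 3-sphere: the unit sphere in 4-dimensional Euclidean space. -/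
local notation "S³" => Metric.sphere (0 : EuclideanSpace ℝ (Fin 4)) 1

/-- The 3-torus: the product of three copies of the circle group. -/
local notation "T³" => Circle × Circle × Circle

open Set Filter Topology

/-- Every nontrivial closed subgroup contains a nontrivial torsion element. -/
def ClosedSubgroupsHaveTorsion (G : Type*) [Group G] [TopologicalSpace G] : Prop :=
  ∀ K : Subgroup G, IsClosed (K : Set G) → K ≠ ⊥ → ∃ g ∈ K, g ≠ 1 ∧ IsOfFinOrder g

theorem ClosedSubgroupsHaveTorsion.prod {G H : Type*} [Group G] [Group H]
    [TopologicalSpace G] [TopologicalSpace H] [T2Space G] [CompactSpace G] [CompactSpace H]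
    (hG : ClosedSubgroupsHaveTorsion G) (hH : ClosedSubgroupsHaveTorsion H) :
    ClosedSubgroupsHaveTorsion (G × H) := by
  intro K hK hne
  by_cases hfib : K.comap (MonoidHom.inr G H) = ⊥
  · have hker : ∀ k ∈ K, k.1 = 1 → k = 1 := by
      rintro ⟨a, b⟩ hk rfl
      have hb : b ∈ K.comap (MonoidHom.inr G H) := by simpa using hk
      rw [hfib, Subgroup.mem_bot] at hb
      simp [hb]
    have hclosed : IsClosed ((K.map (MonoidHom.fst G H) : Subgroup G) : Set G) := by
      have := (hK.isCompact.image continuous_fst).isClosed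
      simpa using this
    have hne' : K.map (MonoidHom.fst G H) ≠ ⊥ := by
      obtain ⟨k, hk, hk1⟩ := K.bot_or_exists_ne_one.resolve_left hne
      intro h
      have : k.1 ∈ K.map (MonoidHom.fst G H) := ⟨k, hk, rfl⟩
      rw [h, Subgroup.mem_bot] at this
      exact hk1 (hker k hk this)
    obtain ⟨_, ⟨k, hk, rfl⟩, hk1, hfin⟩ := hG _ hclosed hne'
    obtain ⟨n, hn, hpow⟩ := isOfFinOrder_iff_pow_eq_one.1 hfin
    refine ⟨k, hk, ?_, isOfFinOrder_iff_pow_eq_one.2 ⟨n, hn, ?_⟩⟩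
    · rintro rfl
      simp at hk1
    · exact hker _ (K.pow_mem hk n) (by simpa using hpow)
  · have hclosed : IsClosed ((K.comap (MonoidHom.inr G H) : Subgroup H) : Set H) :=
      hK.preimage (Continuous.prodMk_right 1)
    obtain ⟨h, hh, h1, hfin⟩ := hH _ hclosed hfib
    refine ⟨(1, h), hh, by simpa [Prod.ext_iff] using h1, ?_⟩
    exact (MonoidHom.inr G H).isOfFinOrder hfin

theorem Circle.closedSubgroupsHaveTorsion : ClosedSubgroupsHaveTorsion Circle := by
  intro K hK hne
  let L : AddSubgroup ℝ := AddSubgroup.comap Circle.expHom K.toAddSubgroup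
  have hL : ∀ t, t ∈ L ↔ Circle.exp t ∈ K := fun t => Iff.rfl
  have hLc : IsClosed (L : Set ℝ) := hK.preimage Circle.exp.continuous
  rcases L.dense_or_cyclic with hd | ⟨a, ha⟩
  · have htop : Circle.exp Real.pi ∈ K := by
      rw [← hL, ← SetLike.mem_coe, ← hLc.closure_eq]
      exact hd _
    refine ⟨_, htop, ?_, isOfFinOrder_iff_pow_eq_one.2 ⟨2, two_pos, ?_⟩⟩
    · intro h
      have := congrArg (fun z : Circle => (z : ℂ)) h
      norm_num [Circle.coe_exp] at this
    · rw [pow_two, ← Circle.exp_add, ← two_mul, Circle.exp_two_pi]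
  · have haK : Circle.exp a ∈ K := by
      rw [← hL, ha]
      exact AddSubgroup.mem_closure_singleton_self a
    refine ⟨_, haK, ?_, ?_⟩
    · intro h1
      apply hne
      rw [eq_bot_iff]
      intro z hz
      obtain ⟨t, rfl⟩ := Circle.exp_surjective z
      rw [← hL, ha, AddSubgroup.mem_closure_singleton] at hz
      obtain ⟨n, rfl⟩ := hz
      simp [h1]
    · have h2 : 2 * Real.pi ∈ L := by simp [hL, K.one_mem]
      rw [ha, AddSubgroup.mem_closure_singleton] at h2
      obtain ⟨n, hn⟩ := h2
      refine isOfFinOrder_iff_zpow_eq_one.2 ⟨n, ?_, ?_⟩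
      · rintro rfl
        simp [Real.pi_ne_zero] at hn
      · rw [← Circle.exp_zsmul, hn, Circle.exp_two_pi]

theorem Circle.countable_isOfFinOrder : {z : Circle | IsOfFinOrder z}.Countable := by
  have h : {z : Circle | IsOfFinOrder z} ⊆
      ⋃ n : ℕ, (fun z : Circle => (z : ℂ)) ⁻¹'
        ((Polynomial.nthRootsFinset (n + 1) (1 : ℂ) : Finset ℂ) : Set ℂ) := by
    intro z hz
    obtain ⟨n, hn, hz⟩ := isOfFinOrder_iff_pow_eq_one.1 hz
    obtain ⟨m, rfl⟩ := Nat.exists_eq_succ_of_ne_zero hn.ne'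
    refine mem_iUnion.2 ⟨m, ?_⟩
    simp only [mem_preimage, SetLike.mem_coe]
    rw [Polynomial.mem_nthRootsFinset (Nat.succ_pos m)]
    exact_mod_cast congrArg (fun z : Circle => (z : ℂ)) hz
  exact (countable_iUnion fun n => ((Finset.finite_toSet _).preimage
    (Circle.coe_injective.injOn)).countable).mono h

theorem countable_isOfFinOrder_prod {G H : Type*} [Group G] [Group H]
    (hG : {g : G | IsOfFinOrder g}.Countable) (hH : {h : H | IsOfFinOrder h}.Countable) :
    {p : G × H | IsOfFinOrder p}.Countable :=
  (hG.prod hH).mono fun _ hp => mem_prod.2 ⟨(MonoidHom.fst G H).isOfFinOrder hp,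
    (MonoidHom.snd G H).isOfFinOrder hp⟩

theorem Circle.not_exists_continuous_section_exp :
    ¬ ∃ s : Circle → ℝ, Continuous s ∧ ∀ z, Circle.exp (s z) = z := by
  rintro ⟨s, hs, h⟩
  have hint : ∀ t : ℝ, ∃ n : ℤ, (s (Circle.exp t) - t) / (2 * Real.pi) = n := fun t => by
    obtain ⟨n, hn⟩ := Circle.exp_eq_exp.1 (h (Circle.exp t))
    exact ⟨n, by rw [hn]; field_simp; ring⟩
  choose n hn using hint
  have hc : Continuous fun t => ((n t : ℤ) : ℝ) := by
    simp_rw [← hn]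
    fun_prop
  have hc' : Continuous n := Int.isClosedEmbedding_coe_real.isInducing.continuous_iff.2 hc
  have h0 := PreconnectedSpace.constant inferInstance hc' (x := 0) (y := 2 * Real.pi)
  have h1 := hn 0
  have h2 := hn (2 * Real.pi)
  rw [← h0, ← h1, Circle.exp_two_pi, Circle.exp_zero] at h2
  field_simp at h2
  linarith [Real.pi_pos]

theorem exists_continuous_circleExp_lift {A : Type*} [TopologicalSpace A]
    [SimplyConnectedSpace A] [LocallyPathConnectedSpace A] {f : A → Circle} (hf : Continuous f) :
    ∃ F : A → ℝ, Continuous F ∧ ∀ a, Circle.exp (F a) = f a := by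
  obtain ⟨a₀⟩ := (inferInstance : Nonempty A)
  obtain ⟨e, he⟩ := Circle.exp_surjective (f a₀)
  obtain ⟨F, ⟨-, hF⟩, -⟩ :=
    Circle.isCoveringMap_exp.existsUnique_continuousMap_lifts ⟨f, hf⟩ a₀ e he
  exact ⟨F, F.continuous, fun a => congrFun hF a⟩

theorem injOn_nhds_of_hasStrictFDerivAt_equiv {E F : Type*} [NormedAddCommGroup E]
    [NormedSpace ℝ E] [CompleteSpace E] [NormedAddCommGroup F] [NormedSpace ℝ F]
    {f : E → F} {f' : E ≃L[ℝ] F} {a : E} (hf : HasStrictFDerivAt f (f' : E →L[ℝ] F) a) :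
    ∃ s ∈ 𝓝 a, InjOn f s :=
  ⟨_, (hf.toOpenPartialHomeomorph f).open_source.mem_nhds hf.mem_toOpenPartialHomeomorph_source,
    (hf.toOpenPartialHomeomorph f).injOn⟩

/-- A `C¹` self-map of finite order of a connected open set that is the identity near some point
is the identity. -/
theorem eq_self_of_iterate_eq_self_of_eventually_eq_self {E : Type*} [NormedAddCommGroup E]
    [NormedSpace ℝ E] [CompleteSpace E] {U : Set E} (hU : IsOpen U) (hUc : IsPreconnected U)
    {g : E → E} (hg : ContDiffOn ℝ 1 g U) (hgU : MapsTo g U U) {n : ℕ} (hn : 0 < n)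
    (hgn : ∀ z ∈ U, g^[n] z = z) {y : E} (hy : y ∈ U) (hgy : ∀ᶠ z in 𝓝 y, g z = z) :
    ∀ z ∈ U, g z = z := by
  have hiter : ∀ k, ContDiffOn ℝ 1 g^[k] U := by
    intro k
    induction k with
    | zero => exact contDiffOn_id
    | succ k ih =>
      rw [Function.iterate_succ]
      exact ih.comp hg hgU
  let φ : E → E := fun z => ∑ k ∈ Finset.range n, g^[k] z
  have hφ : ContDiffOn ℝ 1 φ U := ContDiffOn.sum fun k _ => hiter k
  have hφg : ∀ z ∈ U, φ (g z) = φ z := by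
    intro z hz
    simp only [φ, ← Function.iterate_succ_apply]
    have h1 := Finset.sum_range_succ (fun k => g^[k] z) n
    have h2 := Finset.sum_range_succ' (fun k => g^[k] z) n
    rw [h2, hgn z hz] at h1
    simpa using h1
  let A : Set E := {z | ∀ᶠ w in 𝓝 z, g w = w}
  have hA : IsOpen A := isOpen_setOfPred_eventually_nhds
  have hn0 : (n : ℝ) ≠ 0 := Nat.cast_ne_zero.2 hn.ne'
  let e : E ≃L[ℝ] E := ContinuousLinearEquiv.smulLeft (Units.mk0 (n : ℝ) hn0)
  have hderivA : ∀ z ∈ A, fderiv ℝ φ z = (e : E →L[ℝ] E) := by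
    intro z hz
    have hev : φ =ᶠ[𝓝 z] fun w => (n : ℝ) • w := by
      filter_upwards [hz] with w hw
      simp [φ, Function.iterate_fixed hw, Nat.cast_smul_eq_nsmul]
    refine hev.fderiv_eq.trans (((hasFDerivAt_id z).const_smul (n : ℝ)).fderiv.trans ?_)
    ext v
    simp [e, Units.smul_def]
  have hclosed : closure A ∩ U ⊆ A := by
    rintro z ⟨hzA, hz⟩
    have hgc : ContinuousAt g z := (hg.continuousOn).continuousAt (hU.mem_nhds hz)
    have hφz : ContDiffAt ℝ 1 φ z := hφ.contDiffAt (hU.mem_nhds hz)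
    have hfix : g z = z := by
      have : ∃ᶠ w in 𝓝 z, g w = w :=
        (mem_closure_iff_frequently.1 hzA).mono fun w hw => hw.self_of_nhds
      exact tendsto_nhds_unique_of_frequently_eq hgc tendsto_id this
    have hd : fderiv ℝ φ z = (e : E →L[ℝ] E) := by
      have hc : ContinuousAt (fderiv ℝ φ) z :=
        (hφ.continuousOn_fderiv_of_isOpen hU le_rfl).continuousAt (hU.mem_nhds hz)
      exact tendsto_nhds_unique_of_frequently_eq hc tendsto_const_nhds
        ((mem_closure_iff_frequently.1 hzA).mono hderivA)
    have hstrict : HasStrictFDerivAt φ (e : E →L[ℝ] E) z :=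
      hd ▸ hφz.hasStrictFDerivAt one_ne_zero
    obtain ⟨s, hs, hinj⟩ := injOn_nhds_of_hasStrictFDerivAt_equiv hstrict
    have hgs : ∀ᶠ w in 𝓝 z, g w ∈ s := hgc (by rwa [hfix])
    filter_upwards [hs, hgs, hU.mem_nhds hz] with w hw hgw hwU
    exact hinj hgw hw (hφg w hwU)
  exact fun z hz =>
    (hUc.subset_of_closure_inter_subset hA ⟨y, hy, hgy⟩ hclosed hz).self_of_nhds

/-- If a norm-preserving `C¹` flow of a vector space `V` on `E \ {0}`, with `dim E = dim V + 1`,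
has a unit vector whose stabilizer contains no line, then the orbit of that vector contains a
neighbourhood of it in the unit sphere. -/
theorem eventually_mem_orbit_of_stabilizer_contains_no_line {V E : Type*}
    [NormedAddCommGroup V] [NormedSpace ℝ V] [FiniteDimensional ℝ V]
    [NormedAddCommGroup E] [InnerProductSpace ℝ E] [FiniteDimensional ℝ E]
    (hdim : Module.finrank ℝ E = Module.finrank ℝ V + 1) {Ψ : V × E → E}
    (hΨ : ∀ t y, y ≠ 0 → ContDiffAt ℝ 1 Ψ (t, y)) (hzero : ∀ y, y ≠ 0 → Ψ (0, y) = y)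
    (hadd : ∀ s t y, y ≠ 0 → Ψ (s + t, y) = Ψ (s, Ψ (t, y)))
    (hnorm : ∀ t y, y ≠ 0 → ‖Ψ (t, y)‖ = ‖y‖) {x : E} (hx : ‖x‖ = 1)
    (hstab : ∀ v : V, (∀ r : ℝ, Ψ (r • v, x) = x) → v = 0) :
    ∀ᶠ z in 𝓝 x, ‖z‖ = 1 → ∃ t, Ψ (t, x) = z := by
  have hx0 : x ≠ 0 := norm_ne_zero_iff.1 (by rw [hx]; exact one_ne_zero)
  let o : V → E := fun t => Ψ (t, x)
  have ho0 : o 0 = x := hzero x hx0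
  have ho : ContDiff ℝ 1 o := contDiff_iff_contDiffAt.2 fun t =>
    (hΨ t x hx0).comp t (contDiffAt_id.prodMk contDiffAt_const)
  have hod : ∀ t, HasFDerivAt o (fderiv ℝ o t) t := fun t =>
    (ho.differentiable one_ne_zero t).hasFDerivAt
  set D := fderiv ℝ o 0 with hD
  have hline : ∀ (v : V) (r : ℝ), HasDerivAt (fun r : ℝ => o (r • v)) (fderiv ℝ o (r • v) v) r := by
    intro v r
    have h : HasDerivAt (fun r : ℝ => r • v) v r := by
      simpa using (hasDerivAt_id r).smul_const v
    exact (hod (r • v)).comp_hasDerivAt r h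
  have horth : ∀ v, inner ℝ x (D v) = 0 := by
    intro v
    have h1 := (hline v 0).norm_sq
    have h2 : (fun r : ℝ => ‖o (r • v)‖ ^ 2) = fun _ => 1 := by
      funext r
      simp [o, hnorm _ _ hx0, hx]
    rw [h2] at h1
    have h3 := h1.unique (hasDerivAt_const 0 1)
    simpa [ho0] using h3
  have hDinj : ∀ v, D v = 0 → v = 0 := by
    intro v hv
    apply hstab
    have hder : ∀ r : ℝ, HasDerivAt (fun r : ℝ => o (r • v)) 0 r := by
      intro r
      have hG : HasFDerivAt (fun y => Ψ (r • v, y)) (fderiv ℝ (fun y => Ψ (r • v, y)) x) x :=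
        (((hΨ (r • v) x hx0).comp x (contDiffAt_const.prodMk contDiffAt_id)).differentiableAt
          one_ne_zero).hasFDerivAt
      have h0 := hline v 0
      rw [zero_smul, ← hD, hv] at h0
      have hG' : HasFDerivAt (fun y => Ψ (r • v, y)) (fderiv ℝ (fun y => Ψ (r • v, y)) x)
          (o ((r - r) • v)) := by simpa [ho0] using hG
      have hs : HasDerivAt (fun q : ℝ => o ((q - r) • v)) 0 r := by
        have h0' : HasDerivAt (fun q : ℝ => o (q • v)) 0 (r - r) := by simpa using h0
        exact h0'.comp_sub_const r r
      have h := hG'.comp_hasDerivAt r hs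
      rw [map_zero] at h
      refine h.congr_of_eventuallyEq (Eventually.of_forall fun q => ?_)
      simp only [o, Function.comp_apply, ← hadd _ _ _ hx0]
      rw [← add_smul, add_sub_cancel]
    intro r
    have hconst := is_const_of_deriv_eq_zero (fun r => (hder r).differentiableAt)
      (fun r => (hder r).deriv) r 0
    simpa [o, hzero _ hx0] using hconst
  let Θ : ℝ × V → E := fun p => p.1 • o p.2
  have hΘ : ContDiff ℝ 1 Θ := contDiff_fst.smul (ho.comp contDiff_snd)
  let L : ℝ × V →L[ℝ] E :=
    (ContinuousLinearMap.fst ℝ ℝ V).smulRight x + D.comp (ContinuousLinearMap.snd ℝ ℝ V)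
  have hL : HasFDerivAt Θ L (1, 0) := by
    have h : HasFDerivAt (fun p : ℝ × V => o p.2) (D.comp (ContinuousLinearMap.snd ℝ ℝ V)) (1, 0) :=
      HasFDerivAt.comp (g := o) ((1 : ℝ), (0 : V)) (hod 0) hasFDerivAt_snd
    refine (hasFDerivAt_fst.smul h).congr_fderiv ?_
    ext v <;> simp [L, ho0, hD]
  have hstrict : HasStrictFDerivAt Θ L (1, 0) :=
    hL.fderiv ▸ hΘ.contDiffAt.hasStrictFDerivAt one_ne_zero
  have hLinj : Function.Injective L := by
    rw [injective_iff_map_eq_zero]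
    rintro ⟨s, v⟩ h
    have h' : s • x + D v = 0 := h
    have hs : s = 0 := by
      have := congrArg (inner ℝ x) h'
      simpa [inner_add_right, inner_smul_right, horth, hx] using this
    subst hs
    simp only [zero_smul, zero_add] at h'
    simp [hDinj v h']
  have hLsurj : Function.Surjective L := by
    refine (LinearMap.injective_iff_surjective_of_finrank_eq_finrank (f := (L : ℝ × V →ₗ[ℝ] E))
      ?_).1 hLinj
    rw [hdim, Module.finrank_prod, Module.finrank_self, add_comm]
  have hmap := hstrict.map_nhds_eq_of_surj (LinearMap.range_eq_top.2 hLsurj)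
  have hpos : ∀ᶠ p : ℝ × V in 𝓝 (1, 0), 0 < p.1 :=
    continuous_fst.continuousAt.eventually (lt_mem_nhds one_pos)
  have himg : Θ '' {p | 0 < p.1} ∈ 𝓝 (Θ (1, 0)) := hmap ▸ image_mem_map hpos
  have hΘ1 : Θ (1, 0) = x := by simp [Θ, ho0]
  rw [hΘ1] at himg
  filter_upwards [himg] with z hz hz1
  obtain ⟨⟨s, t⟩, hs, rfl⟩ := hz
  refine ⟨t, ?_⟩
  have hs1 : s = 1 := by
    simpa [Θ, o, norm_smul, hnorm _ _ hx0, hx, abs_of_pos (show 0 < s from hs)] using hz1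
  simp [Θ, o, hs1]

theorem isEmpty_homeomorph_circle_prod_sphere {E Y : Type*} [NormedAddCommGroup E]
    [InnerProductSpace ℝ E] [TopologicalSpace Y] [Nontrivial Y] :
    IsEmpty (Circle × Y ≃ₜ Metric.sphere (0 : E) 1) := by
  refine ⟨fun e => Circle.not_exists_continuous_section_exp ?_⟩
  obtain ⟨y, y', hy⟩ := exists_pair_ne Y
  set v := e (1, y')
  have hv : ‖(v : E)‖ = 1 := by simp
  let c := stereographic hv
  obtain ⟨F, hF, hFc⟩ := exists_continuous_circleExp_lift (A := (ℝ ∙ (v : E))ᗮ)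
    (f := fun w => (e.symm (c.symm w)).1)
    (continuous_fst.comp (e.symm.continuous.comp
      (isOpenEmbedding_stereographic_symm hv).continuous))
  have hsource : ∀ z, e (z, y) ∈ c.source := by
    intro z
    simp only [c, stereographic_source, mem_compl_iff, mem_singleton_iff]
    intro h
    have : e (z, y) = v := h
    exact hy (congrArg Prod.snd (e.injective this))
  refine ⟨fun z => F (c (e (z, y))), hF.comp ?_, fun z => ?_⟩
  · exact c.continuousOn.comp_continuous (by fun_prop) hsource
  · rw [hFc, c.left_inv (hsource z), e.symm_apply_apply]

/-- The radial projection onto the unit sphere, with the junk value `p` at the origin. -/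
noncomputable def radialProj {E : Type*} [NormedAddCommGroup E] [NormedSpace ℝ E]
    (p : Metric.sphere (0 : E) 1) (y : E) : Metric.sphere (0 : E) 1 :=
  open Classical in
  if h : y = 0 then p else ⟨‖y‖⁻¹ • y, by simp [norm_smul, h]⟩

section RadialProj

variable {E : Type*} [NormedAddCommGroup E]

theorem coe_radialProj [NormedSpace ℝ E] (p : Metric.sphere (0 : E) 1) {y : E} (hy : y ≠ 0) :
    (radialProj p y : E) = ‖y‖⁻¹ • y := by
  simp [radialProj, hy]

theorem norm_smul_radialProj [NormedSpace ℝ E] (p : Metric.sphere (0 : E) 1) {y : E}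
    (hy : y ≠ 0) : ‖y‖ • (radialProj p y : E) = y := by
  rw [coe_radialProj p hy, smul_smul, mul_inv_cancel₀ (norm_ne_zero_iff.2 hy), one_smul]

theorem radialProj_smul [NormedSpace ℝ E] (p x : Metric.sphere (0 : E) 1) {r : ℝ} (hr : 0 < r) :
    radialProj p (r • (x : E)) = x := by
  have hx : ‖(x : E)‖ = 1 := by simp
  have hx0 : (x : E) ≠ 0 := norm_ne_zero_iff.1 (by rw [hx]; exact one_ne_zero)
  ext1
  rw [coe_radialProj p (smul_ne_zero hr.ne' hx0), norm_smul, hx, mul_one, Real.norm_of_nonneg hr.le,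
    smul_smul, inv_mul_cancel₀ hr.ne', one_smul]

theorem radialProj_coe [NormedSpace ℝ E] (p x : Metric.sphere (0 : E) 1) :
    radialProj p (x : E) = x := by
  simpa using radialProj_smul p x one_pos

theorem contMDiffAt_radialProj [InnerProductSpace ℝ E] {n : ℕ} {m : WithTop ℕ∞}
    [Fact (Module.finrank ℝ E = n + 1)] (p : Metric.sphere (0 : E) 1) {y : E} (hy : y ≠ 0) :
    ContMDiffAt 𝓘(ℝ, E) (𝓡 n) m (radialProj p) y := by
  let U : TopologicalSpace.Opens E := ⟨{0}ᶜ, isOpen_compl_singleton⟩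
  have h : ContMDiff 𝓘(ℝ, E) 𝓘(ℝ, E) m fun z : U => ‖(z : E)‖⁻¹ • (z : E) := by
    intro z
    refine (contMDiffAt_subtype_iff (f := fun z : E => ‖z‖⁻¹ • z)).2
      (ContDiffAt.contMDiffAt ?_)
    have hz : (z : E) ≠ 0 := z.2
    exact ((contDiffAt_norm ℝ hz).inv (norm_ne_zero_iff.2 hz)).smul contDiffAt_id
  have hmem : ∀ z : U, ‖(z : E)‖⁻¹ • (z : E) ∈ Metric.sphere (0 : E) 1 := by
    intro z
    have hz : (z : E) ≠ 0 := z.2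
    simp [norm_smul, hz]
  have h' := h.codRestrict_sphere (n := n) hmem
  have heq : (fun z : U => radialProj p (z : E)) = codRestrict _ _ hmem := by
    funext z
    have hz : (z : E) ≠ 0 := z.2
    ext1
    simp [coe_radialProj p hz]
  refine (contMDiffAt_subtype_iff (x := (⟨y, hy⟩ : U)) (f := radialProj p)).1 ?_
  rw [heq]
  exact h' ⟨y, hy⟩

end RadialProj

/-- The exponential map of the 3-torus. -/
noncomputable def torusExp (t : ℝ × ℝ × ℝ) : T³ :=
  (Circle.exp t.1, Circle.exp t.2.1, Circle.exp t.2.2)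

theorem torusExp_add (s t : ℝ × ℝ × ℝ) : torusExp (s + t) = torusExp s * torusExp t := by
  simp [torusExp]

theorem torusExp_zero : torusExp 0 = 1 := by
  simp [torusExp, Prod.ext_iff]

theorem contMDiff_torusExp {m : WithTop ℕ∞} :
    ContMDiff 𝓘(ℝ, ℝ × ℝ × ℝ) ((𝓡 1).prod ((𝓡 1).prod (𝓡 1))) m torusExp :=
  (contMDiff_circleExp.comp contDiff_fst.contMDiff).prodMk
    ((contMDiff_circleExp.comp (contDiff_fst.comp contDiff_snd).contMDiff).prodMk
      (contMDiff_circleExp.comp (contDiff_snd.comp contDiff_snd).contMDiff))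

theorem eq_zero_of_circleExp_mul_eq_one {a : ℝ} (h : ∀ r : ℝ, Circle.exp (r * a) = 1) : a = 0 := by
  by_contra ha
  have h1 := congrArg (fun z : Circle => (z : ℂ)) (h (Real.pi / a))
  norm_num [Circle.coe_exp, div_mul_cancel₀ _ ha] at h1

instance Circle.instNontrivial : Nontrivial Circle := by
  by_contra h
  rw [not_nontrivial_iff_subsingleton] at h
  exact one_ne_zero (eq_zero_of_circleExp_mul_eq_one fun r =>
    Subsingleton.elim (Circle.exp (r * 1)) 1)

theorem eq_zero_of_torusExp_smul_eq_one {v : ℝ × ℝ × ℝ} (h : ∀ r : ℝ, torusExp (r • v) = 1) :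
    v = 0 := by
  simp only [torusExp, Prod.ext_iff, Prod.smul_fst, Prod.smul_snd, smul_eq_mul, Prod.fst_one,
    Prod.snd_one] at h
  exact Prod.ext (eq_zero_of_circleExp_mul_eq_one fun r => (h r).1)
    (Prod.ext (eq_zero_of_circleExp_mul_eq_one fun r => (h r).2.1)
      (eq_zero_of_circleExp_mul_eq_one fun r => (h r).2.2))

theorem torusExp_surjective : Function.Surjective torusExp := by
  rintro ⟨a, b, c⟩
  obtain ⟨r, rfl⟩ := Circle.exp_surjective a
  obtain ⟨s, rfl⟩ := Circle.exp_surjective b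
  obtain ⟨t, rfl⟩ := Circle.exp_surjective c
  exact ⟨(r, s, t), rfl⟩

theorem closedSubgroupsHaveTorsion_torus : ClosedSubgroupsHaveTorsion T³ :=
  Circle.closedSubgroupsHaveTorsion.prod
    (Circle.closedSubgroupsHaveTorsion.prod Circle.closedSubgroupsHaveTorsion)

theorem countable_isOfFinOrder_torus : {g : T³ | IsOfFinOrder g}.Countable :=
  countable_isOfFinOrder_prod Circle.countable_isOfFinOrder
    (countable_isOfFinOrder_prod Circle.countable_isOfFinOrder Circle.countable_isOfFinOrder)

theorem one_lt_rank_ambient : 1 < Module.rank ℝ (EuclideanSpace ℝ (Fin 4)) := by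
  rw [← Module.finrank_eq_rank, finrank_euclideanSpace_fin]
  norm_num

/-- A smooth action of the 3-torus on the 3-sphere. -/
structure IsSmoothTorusAction (μ : T³ × S³ → S³) : Prop where
  contMDiff :
    ContMDiff (((𝓡 1).prod ((𝓡 1).prod (𝓡 1))).prod (𝓡 3)) (𝓡 3) (⊤ : ℕ∞) μ
  one : ∀ x : S³, μ (1, x) = x
  mul : ∀ (g h : T³) (x : S³), μ (g * h, x) = μ (g, μ (h, x))

/-- The radial extension of a self-map of the unit sphere to the ambient space. -/
noncomputable def radialExt {E : Type*} [NormedAddCommGroup E] [NormedSpace ℝ E]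
    (p : Metric.sphere (0 : E) 1) (f : Metric.sphere (0 : E) 1 → Metric.sphere (0 : E) 1) (y : E) :
    E :=
  ‖y‖ • (f (radialProj p y) : E)

section RadialExt

variable {E : Type*} [NormedAddCommGroup E] [NormedSpace ℝ E] (p : Metric.sphere (0 : E) 1)
  (f g : Metric.sphere (0 : E) 1 → Metric.sphere (0 : E) 1)

theorem norm_radialExt (y : E) : ‖radialExt p f y‖ = ‖y‖ := by
  have : ‖(f (radialProj p y) : E)‖ = 1 := by simp
  simp [radialExt, norm_smul, this]

theorem radialExt_ne_zero {y : E} (hy : y ≠ 0) : radialExt p f y ≠ 0 := by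
  rw [← norm_ne_zero_iff, norm_radialExt]
  exact norm_ne_zero_iff.2 hy

theorem radialExt_id {y : E} (hy : y ≠ 0) : radialExt p id y = y :=
  norm_smul_radialProj p hy

theorem radialExt_comp {y : E} (hy : y ≠ 0) :
    radialExt p (f ∘ g) y = radialExt p f (radialExt p g y) := by
  rw [radialExt, radialExt, norm_radialExt, radialExt, radialProj_smul p _ (norm_pos_iff.2 hy)]
  rfl

theorem radialExt_coe (x : Metric.sphere (0 : E) 1) : radialExt p f x = f x := by
  have hx : ‖(x : E)‖ = 1 := by simp
  rw [radialExt, radialProj_coe, hx, one_smul]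

theorem radialExt_iterate {y : E} (hy : y ≠ 0) (n : ℕ) :
    radialExt p f^[n] y = (radialExt p f)^[n] y := by
  induction n with
  | zero => exact radialExt_id p hy
  | succ n ih =>
    rw [Function.iterate_succ', Function.iterate_succ_apply', ← ih, ← radialExt_comp p f _ hy]

end RadialExt

namespace IsSmoothTorusAction

variable {μ : T³ × S³ → S³}

theorem continuous (h : IsSmoothTorusAction μ) : Continuous μ := h.contMDiff.continuous

theorem contDiffAt_radialExt (h : IsSmoothTorusAction μ) (p : S³) (t : ℝ × ℝ × ℝ)
    {y : EuclideanSpace ℝ (Fin 4)} (hy : y ≠ 0) :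
    ContDiffAt ℝ 1 (fun q : (ℝ × ℝ × ℝ) × EuclideanSpace ℝ (Fin 4) =>
      radialExt p (fun x => μ (torusExp q.1, x)) q.2) (t, y) := by
  have h1 : ContMDiffAt 𝓘(ℝ, (ℝ × ℝ × ℝ) × EuclideanSpace ℝ (Fin 4))
      (((𝓡 1).prod ((𝓡 1).prod (𝓡 1))).prod (𝓡 3)) 1
      (fun q : (ℝ × ℝ × ℝ) × EuclideanSpace ℝ (Fin 4) => (torusExp q.1, radialProj p q.2)) (t, y) :=
    (contMDiff_torusExp.contMDiffAt.comp (t, y) contDiff_fst.contMDiff.contMDiffAt).prodMk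
      (ContMDiffAt.comp (t, y) (contMDiffAt_radialProj p hy) contDiff_snd.contMDiff.contMDiffAt)
  have h2 : ContMDiff (((𝓡 1).prod ((𝓡 1).prod (𝓡 1))).prod (𝓡 3)) (𝓡 3) 1 μ :=
    h.contMDiff.of_le (by exact_mod_cast le_top)
  have h3 := (contMDiff_coe_sphere.comp h2).contMDiffAt.comp (t, y) h1
  have h4 : ContDiffAt ℝ 1 (fun q : (ℝ × ℝ × ℝ) × EuclideanSpace ℝ (Fin 4) =>
      (μ (torusExp q.1, radialProj p q.2) : EuclideanSpace ℝ (Fin 4))) (t, y) :=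
    contMDiffAt_iff_contDiffAt.1 h3
  exact ((contDiffAt_norm ℝ hy).comp (t, y) contDiffAt_snd).smul h4

theorem radialExt_mul (h : IsSmoothTorusAction μ) (p : S³) (g k : T³)
    {y : EuclideanSpace ℝ (Fin 4)} (hy : y ≠ 0) :
    radialExt p (fun x => μ (g * k, x)) y =
      radialExt p (fun x => μ (g, x)) (radialExt p (fun x => μ (k, x)) y) := by
  rw [← radialExt_comp p _ _ hy]
  congr 1
  funext x
  exact h.mul g k x

theorem radialExt_one (h : IsSmoothTorusAction μ) (p : S³)
    {y : EuclideanSpace ℝ (Fin 4)} (hy : y ≠ 0) :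
    radialExt p (fun x => μ (1, x)) y = y := by
  rw [funext h.one]
  exact radialExt_id p hy

theorem iterate (h : IsSmoothTorusAction μ) (g : T³) (n : ℕ) :
    (fun x => μ (g, x))^[n] = fun x => μ (g ^ n, x) := by
  induction n with
  | zero => funext x; simp [h.one]
  | succ n ih =>
    rw [Function.iterate_succ', ih, pow_succ']
    funext x
    exact (h.mul g _ x).symm

/-- An element of finite order whose fixed point set has nonempty interior acts trivially. -/
theorem eq_self_of_isOfFinOrder (h : IsSmoothTorusAction μ) {g : T³} (hg : IsOfFinOrder g)
    (hint : (interior {x | μ (g, x) = x}).Nonempty) (x : S³) : μ (g, x) = x := by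
  obtain ⟨n, hn, hgn⟩ := isOfFinOrder_iff_pow_eq_one.1 hg
  obtain ⟨p, hp⟩ := hint
  have hne : ∀ x : S³, (x : EuclideanSpace ℝ (Fin 4)) ≠ 0 := fun x =>
    ne_zero_of_mem_unit_sphere x
  obtain ⟨t, rfl⟩ := torusExp_surjective g
  have hfix : ∀ z ∈ ({0}ᶜ : Set (EuclideanSpace ℝ (Fin 4))),
      radialExt p (fun x => μ (torusExp t, x)) z = z := by
    refine eq_self_of_iterate_eq_self_of_eventually_eq_self (n := n) (y := p)
      isOpen_compl_singleton
      (isConnected_compl_singleton_of_one_lt_rank one_lt_rank_ambient 0).isPreconnected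
      (fun y hy => ?_) (fun y hy => radialExt_ne_zero _ _ hy) hn (fun z hz => ?_) (hne p) ?_
    · exact ((h.contDiffAt_radialExt p t hy).comp y
        (contDiffAt_const.prodMk contDiffAt_id)).contDiffWithinAt
    · rw [← radialExt_iterate _ _ hz, h.iterate, hgn]
      exact h.radialExt_one p hz
    · have hc : ContinuousAt (radialProj p) (p : EuclideanSpace ℝ (Fin 4)) :=
        (contMDiffAt_radialProj (n := 3) (m := 0) p (hne p)).continuousAt
      have hnhds : {x | μ (torusExp t, x) = x} ∈
          𝓝 (radialProj p (p : EuclideanSpace ℝ (Fin 4))) := by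
        rw [radialProj_coe]
        exact mem_interior_iff_mem_nhds.1 hp
      filter_upwards [hc hnhds, isOpen_compl_singleton.mem_nhds (hne p)] with z hz hz0
      have hz' : μ (torusExp t, radialProj p z) = radialProj p z := hz
      rw [radialExt, hz', norm_smul_radialProj p hz0]
  have := hfix x (hne x)
  rw [radialExt_coe] at this
  exact Subtype.ext this

/-- The stabilizer of a point. -/
def stabilizer (h : IsSmoothTorusAction μ) (x : S³) : Subgroup T³ where
  carrier := {g | μ (g, x) = x}
  one_mem' := h.one x
  mul_mem' := fun {a b} (ha : μ (a, x) = x) (hb : μ (b, x) = x) =>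
    show μ (a * b, x) = x by rw [h.mul, hb, ha]
  inv_mem' := fun {a} (ha : μ (a, x) = x) => show μ (a⁻¹, x) = x by
    nth_rewrite 1 [← ha]
    rw [← h.mul, inv_mul_cancel, h.one]

theorem mem_stabilizer (h : IsSmoothTorusAction μ) {x : S³} {g : T³} :
    g ∈ h.stabilizer x ↔ μ (g, x) = x :=
  Iff.rfl

theorem isClosed_stabilizer (h : IsSmoothTorusAction μ) (x : S³) :
    IsClosed (h.stabilizer x : Set T³) :=
  isClosed_eq (h.continuous.comp (Continuous.prodMk_left x)) continuous_const

theorem isClosed_fixedPoints (h : IsSmoothTorusAction μ) (g : T³) :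
    IsClosed {x | μ (g, x) = x} :=
  isClosed_eq (h.continuous.comp (Continuous.prodMk_right g)) continuous_id

/-- An effective action has a point with trivial stabilizer. -/
theorem exists_trivial_stabilizer (h : IsSmoothTorusAction μ)
    (heff : ∀ g : T³, g ≠ 1 → ∃ x : S³, μ (g, x) ≠ x) :
    ∃ x : S³, ∀ g : T³, μ (g, x) = x → g = 1 := by
  by_contra hcon
  have hcover : ⋃ g ∈ {g : T³ | IsOfFinOrder g ∧ g ≠ 1}, {x | μ (g, x) = x} = univ := by
    refine eq_univ_of_forall fun x => ?_
    have hne : h.stabilizer x ≠ ⊥ := fun hbot =>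
      hcon ⟨x, fun g hg => Subgroup.mem_bot.1 (hbot ▸ h.mem_stabilizer.2 hg)⟩
    obtain ⟨k, hk, hk1, hfin⟩ := closedSubgroupsHaveTorsion_torus _ (h.isClosed_stabilizer x) hne
    exact mem_iUnion₂.2 ⟨k, ⟨hfin, hk1⟩, hk⟩
  have : Nonempty S³ :=
    (isConnected_sphere one_lt_rank_ambient 0 zero_le_one).nonempty.to_subtype
  obtain ⟨y, hy⟩ := (dense_biUnion_interior_of_closed (fun g _ => h.isClosed_fixedPoints g)
    (countable_isOfFinOrder_torus.mono fun g hg => hg.1) hcover).nonempty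
  obtain ⟨g, ⟨hfin, hg1⟩, hyg⟩ := mem_iUnion₂.1 hy
  obtain ⟨x, hx⟩ := heff g hg1
  exact hx (h.eq_self_of_isOfFinOrder hfin ⟨y, hyg⟩ x)

/-- The orbit of a point with trivial stabilizer is a neighbourhood of that point. -/
theorem range_orbit_mem_nhds (h : IsSmoothTorusAction μ) {x : S³}
    (hx : ∀ g : T³, μ (g, x) = x → g = 1) : range (fun g => μ (g, x)) ∈ 𝓝 x := by
  have hev := eventually_mem_orbit_of_stabilizer_contains_no_line
    (V := ℝ × ℝ × ℝ) (E := EuclideanSpace ℝ (Fin 4))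
    (Ψ := fun q => radialExt x (fun x => μ (torusExp q.1, x)) q.2) (x := x) (by simp)
    (fun t y hy => h.contDiffAt_radialExt x t hy)
    (fun y hy => by simpa [torusExp_zero] using h.radialExt_one x hy)
    (fun s t y hy => by simpa [torusExp_add] using h.radialExt_mul x _ _ hy)
    (fun t y _ => norm_radialExt _ _ y) (by simp)
    (fun v hv => eq_zero_of_torusExp_smul_eq_one fun r => hx _ <| Subtype.ext <| by
      simpa [radialExt_coe] using hv r)
  filter_upwards [continuous_subtype_val.continuousAt hev] with z hz
  obtain ⟨t, ht⟩ := hz (by simp)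
  refine ⟨torusExp t, Subtype.ext ?_⟩
  simpa [radialExt_coe] using ht

/-- The action is transitive as soon as some point has trivial stabilizer. -/
theorem surjective_orbit (h : IsSmoothTorusAction μ) {x : S³}
    (hx : ∀ g : T³, μ (g, x) = x → g = 1) : Function.Surjective fun g => μ (g, x) := by
  have : PreconnectedSpace S³ := isPreconnected_iff_preconnectedSpace.1
    (isPreconnected_sphere one_lt_rank_ambient 0 1)
  have hclosed : IsClosed (range fun g => μ (g, x)) :=
    (isCompact_range (h.continuous.comp (Continuous.prodMk_left x))).isClosed
  have hopen : IsOpen (range fun g => μ (g, x)) := by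
    rw [isOpen_iff_mem_nhds]
    rintro _ ⟨g, rfl⟩
    have hc : ContinuousAt (fun z => μ (g⁻¹, z)) (μ (g, x)) :=
      (h.continuous.comp (Continuous.prodMk_right g⁻¹)).continuousAt
    have hgx : μ (g⁻¹, μ (g, x)) = x := by rw [← h.mul, inv_mul_cancel, h.one]
    filter_upwards [hc (by simpa only [hgx] using h.range_orbit_mem_nhds hx)] with z hz
    obtain ⟨k, hk⟩ := hz
    refine ⟨g * k, ?_⟩
    have hk' : μ (k, x) = μ (g⁻¹, z) := hk
    simp only [h.mul, hk']
    rw [← h.mul, mul_inv_cancel, h.one]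
  exact range_eq_univ.1 (IsClopen.eq_univ ⟨hclosed, hopen⟩ ⟨_, mem_range_self 1⟩)

end IsSmoothTorusAction

/-- **The 3-torus cannot act smoothly and effectively on the 3-sphere.**
There is no smooth map `μ : T³ × S³ → S³` satisfying the action axioms
(`μ(1, x) = x` and `μ(gh, x) = μ(g, μ(h, x))`) which is effective
(every `g ≠ 1` moves some point). -/
theorem no_smooth_effective_torus3_action_on_sphere3 :
    ¬ ∃ μ : (Circle × Circle × Circle) × S³ → S³,
      ContMDiff (((𝓡 1).prod ((𝓡 1).prod (𝓡 1))).prod (𝓡 3)) (𝓡 3) (⊤ : ℕ∞) μ ∧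
      (∀ x : S³, μ (1, x) = x) ∧
      (∀ (g h : Circle × Circle × Circle) (x : S³), μ (g * h, x) = μ (g, μ (h, x))) ∧
      (∀ g : Circle × Circle × Circle, g ≠ 1 → ∃ x : S³, μ (g, x) ≠ x) := by
  rintro ⟨μ, hsmooth, hone, hmul, heff⟩
  have h : IsSmoothTorusAction μ := ⟨hsmooth, hone, hmul⟩
  obtain ⟨x, hx⟩ := h.exists_trivial_stabilizer heff
  have hinj : Function.Injective fun g => μ (g, x) := by
    intro g k (hgk : μ (g, x) = μ (k, x))
    refine (inv_mul_eq_one.1 (hx (k⁻¹ * g) ?_)).symm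
    rw [hmul, hgk, ← hmul, inv_mul_cancel, hone]
  exact isEmpty_homeomorph_circle_prod_sphere.false
    (Continuous.homeoOfEquivCompactToT2
      (f := Equiv.ofBijective _ ⟨hinj, h.surjective_orbit hx⟩)
      (h.continuous.comp (Continuous.prodMk_left x)))
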